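/- arXiv:2505.05984 — 2 statements merged into one kernel-verified Lean document; each statement's English description precedes it below -/
import Mathlib

section
/- For all natural numbers l, m with m ≥ 1 and l ≥ 1, the following identity of signed Stirling numbers of the first kind holds: 2*l*s(1+m, 1+l) = ((m+1)/(l+m-1)) * ∑_{n=1}^{l} ∑_{k=0}^{m-1} C(l+m-2, n+k-1)^{-1} * C(m, k) * C(m, 1+k) * s(1+k, n) * s(m-k, l+1-n). -/
/-- Signed Stirling numbers of the first kind, defined via the recurrence coming from
the rising-factorial identity `x⁽ⁿ⁾ = ∑ₖ (-1)^(n-k) s(n,k) xᵏ`, equivalently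
`x(x-1)⋯(x-n+1) = ∑ₖ s(n,k) xᵏ`. -/
def stirlingS1 : ℕ → ℕ → ℤ
  | 0, 0 => 1
  | 0, _ + 1 => 0
  | _ + 1, 0 => 0
  | n + 1, k + 1 => stirlingS1 n k - n * stirlingS1 n (k + 1)

section PowerSeriesFlow

open PowerSeries

/-- The coefficientwise Euler operator `x ∂/∂x` on `ℚ⟦x⟧⟦y⟧`, where `x` is the inner variable. -/
noncomputable def innerEuler (f : ℚ⟦X⟧⟦X⟧) : ℚ⟦X⟧⟦X⟧ :=
  PowerSeries.mk fun n => X * d⁄dX ℚ (coeff n f)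

theorem innerEuler_add (f g : ℚ⟦X⟧⟦X⟧) :
    innerEuler (f + g) = innerEuler f + innerEuler g := by
  ext1 n
  simp [innerEuler, mul_add]

theorem innerEuler_smul (c : ℚ) (f : ℚ⟦X⟧⟦X⟧) :
    innerEuler (c • f) = c • innerEuler f := by
  ext1 n
  simp [innerEuler]

theorem innerEuler_mul (f g : ℚ⟦X⟧⟦X⟧) :
    innerEuler (f * g) = innerEuler f * g + f * innerEuler g := by
  ext1 n
  simp only [innerEuler, coeff_mk, coeff_mul, map_sum, map_add, Finset.mul_sum,
    ← Finset.sum_add_distrib, Derivation.leibniz, smul_eq_mul]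
  exact Finset.sum_congr rfl fun _ _ => by ring

theorem innerEuler_pow_succ (f : ℚ⟦X⟧⟦X⟧) (n : ℕ) :
    innerEuler (f ^ (n + 1)) = ((n : ℚ) + 1) • (f ^ n * innerEuler f) := by
  induction n with
  | zero => simp
  | succ n ih =>
    rw [pow_succ, innerEuler_mul, ih]
    push_cast
    simp only [Algebra.smul_def, map_add, map_one]
    ring

theorem derivative_innerEuler (f : ℚ⟦X⟧⟦X⟧) :
    d⁄dX ℚ⟦X⟧ (innerEuler f) = innerEuler (d⁄dX ℚ⟦X⟧ f) := by
  ext1 n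
  simp only [innerEuler, coeff_mk, coeff_derivative, Derivation.leibniz, smul_eq_mul]
  have : d⁄dX ℚ ((n : ℚ⟦X⟧) + 1) = 0 := by simp
  rw [this]
  ring

/-- `∏ i ∈ [1, n], (x ∂/∂x + i - r)` as an operator on `ℚ⟦x⟧⟦y⟧`. -/
noncomputable def eulerProd (r : ℚ) : ℕ → ℚ⟦X⟧⟦X⟧ → ℚ⟦X⟧⟦X⟧
  | 0, f => f
  | n + 1, f => eulerProd r n (innerEuler f + ((n : ℚ) + 1 - r) • f)

theorem derivative_smul_rat (c : ℚ) (f : ℚ⟦X⟧⟦X⟧) :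
    d⁄dX ℚ⟦X⟧ (c • f) = c • d⁄dX ℚ⟦X⟧ f := by
  ext1 n
  simp [coeff_derivative]

theorem derivative_eulerProd (r : ℚ) (n : ℕ) (f : ℚ⟦X⟧⟦X⟧) :
    d⁄dX ℚ⟦X⟧ (eulerProd r n f) = eulerProd r n (d⁄dX ℚ⟦X⟧ f) := by
  induction n generalizing f with
  | zero => rfl
  | succ n ih =>
    simp only [eulerProd, ih, map_add, derivative_innerEuler, derivative_smul_rat]

theorem coeff_eulerProd (r : ℚ) (n j k : ℕ) (f : ℚ⟦X⟧⟦X⟧) :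
    coeff j (coeff k (eulerProd r n f)) =
      (∏ i ∈ Finset.range n, ((j : ℚ) + i + 1 - r)) * coeff j (coeff k f) := by
  induction n generalizing f with
  | zero => simp [eulerProd]
  | succ n ih =>
    have h : coeff j (X * d⁄dX ℚ (coeff k f)) = (j : ℚ) * coeff j (coeff k f) := by
      cases j with
      | zero => simp
      | succ j => simp [coeff_succ_X_mul, coeff_derivative, mul_comm]
    rw [eulerProd, ih, Finset.prod_range_succ]
    simp only [innerEuler, map_add, coeff_mk, h, coeff_smul, smul_eq_mul]
    ring

/-- Lagrange inversion for the flow `∂U/∂y = q (x ∂/∂x - r) U`, `∂q/∂y = q (q + x ∂q/∂x)`. -/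
theorem iterate_derivative_eq_eulerProd {r : ℚ} {q U : ℚ⟦X⟧⟦X⟧}
    (hq : d⁄dX ℚ⟦X⟧ q = q * (q + innerEuler q))
    (hU : d⁄dX ℚ⟦X⟧ U = q * (innerEuler U - r • U)) (n : ℕ) :
    (d⁄dX ℚ⟦X⟧)^[n + 1] U = eulerProd r n (q ^ (n + 1) * (innerEuler U - r • U)) := by
  induction n with
  | zero => simp [eulerProd, hU]
  | succ n ih =>
    rw [Function.iterate_succ_apply', ih, derivative_eulerProd, eulerProd]
    congr 1
    simp only [Derivation.leibniz, Derivation.leibniz_pow, innerEuler_mul, innerEuler_pow_succ,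
      map_sub, derivative_innerEuler, hU, hq, derivative_smul_rat, smul_eq_mul, nsmul_eq_mul,
      Nat.add_sub_cancel]
    simp only [Algebra.smul_def, map_add, map_one, map_sub, map_natCast]
    push_cast
    ring

theorem coeff_of_flow {r : ℚ} {q U : ℚ⟦X⟧⟦X⟧}
    (hq : d⁄dX ℚ⟦X⟧ q = q * (q + innerEuler q))
    (hU : d⁄dX ℚ⟦X⟧ U = q * (innerEuler U - r • U)) (hU0 : coeff 0 U = 1) (n j : ℕ) :
    ((n + 1).factorial : ℚ) * coeff j (coeff (n + 1) U) =
      -r * (∏ i ∈ Finset.range n, ((j : ℚ) + i + 1 - r)) * coeff j (coeff 0 q ^ (n + 1)) := by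
  have h := congrArg (fun f => coeff j (coeff 0 f)) (iterate_derivative_eq_eulerProd hq hU n)
  have hZ : coeff 0 (innerEuler U - r • U) = C (-r) := by
    ext k
    rw [coeff_zero_eq_constantCoeff_apply] at hU0
    simp [innerEuler, hU0, coeff_C, coeff_one]
  have hfact : coeff 0 ((d⁄dX ℚ⟦X⟧)^[n + 1] U) =
      C ((n + 1).factorial : ℚ) * coeff (n + 1) U := by
    rw [coeff_zero_eq_constantCoeff_apply, constantCoeff_iterate_derivative, map_natCast]
  simp only [hfact, coeff_eulerProd, coeff_C_mul] at h
  rw [h, coeff_zero_eq_constantCoeff_apply, map_mul, map_pow, ← coeff_zero_eq_constantCoeff_apply,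
    ← coeff_zero_eq_constantCoeff_apply, hZ, coeff_mul_C]
  ring

/-- Coefficients of the solution of `∂q/∂y = q (q + x ∂q/∂x)` with initial value `φ`. -/
noncomputable def flowCoeff (φ : ℚ⟦X⟧) : ℕ → ℚ⟦X⟧
  | 0 => φ
  | n + 1 => ((n : ℚ) + 1)⁻¹ • ∑ i : Fin (n + 1),
      flowCoeff φ i * (flowCoeff φ (n - i) + X * d⁄dX ℚ (flowCoeff φ (n - i)))
decreasing_by all_goals omega

/-- Coefficients of the solution of `∂V/∂y = q (x ∂V/∂x - V)` with initial value `1`. -/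
noncomputable def transportCoeff (q : ℚ⟦X⟧⟦X⟧) : ℕ → ℚ⟦X⟧
  | 0 => 1
  | n + 1 => ((n : ℚ) + 1)⁻¹ • ∑ i : Fin (n + 1),
      coeff i q * (X * d⁄dX ℚ (transportCoeff q (n - i)) - transportCoeff q (n - i))
decreasing_by all_goals omega

theorem inv_smul_mul_cast_succ (n : ℕ) (f : ℚ⟦X⟧) :
    (((n : ℚ) + 1)⁻¹ • f) * ((n : ℚ⟦X⟧) + 1) = f := by
  have h : (n : ℚ⟦X⟧) + 1 = C ((n : ℚ) + 1) := by simp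
  ext j
  rw [h, coeff_mul_C, coeff_smul, smul_eq_mul]
  field_simp

theorem exists_flow (φ : ℚ⟦X⟧) : ∃ q : ℚ⟦X⟧⟦X⟧,
    coeff 0 q = φ ∧ d⁄dX ℚ⟦X⟧ q = q * (q + innerEuler q) := by
  refine ⟨PowerSeries.mk (flowCoeff φ), by simp [flowCoeff], ?_⟩
  ext1 n
  rw [coeff_derivative, coeff_mk, flowCoeff, coeff_mul,
    Finset.Nat.sum_antidiagonal_eq_sum_range_succ_mk, ← Fin.sum_univ_eq_sum_range
      (fun i => coeff i (PowerSeries.mk (flowCoeff φ)) *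
        coeff (n - i) (PowerSeries.mk (flowCoeff φ) + innerEuler (PowerSeries.mk (flowCoeff φ))))]
  simp only [map_add, innerEuler, coeff_mk]
  exact inv_smul_mul_cast_succ n _

theorem exists_transport (q : ℚ⟦X⟧⟦X⟧) : ∃ V : ℚ⟦X⟧⟦X⟧,
    coeff 0 V = 1 ∧ d⁄dX ℚ⟦X⟧ V = q * (innerEuler V - (1 : ℚ) • V) := by
  refine ⟨PowerSeries.mk (transportCoeff q), by simp [transportCoeff], ?_⟩
  ext1 n
  rw [coeff_derivative, coeff_mk, transportCoeff, coeff_mul,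
    Finset.Nat.sum_antidiagonal_eq_sum_range_succ_mk, ← Fin.sum_univ_eq_sum_range
      (fun i => coeff i q * coeff (n - i) (innerEuler (PowerSeries.mk (transportCoeff q)) -
        (1 : ℚ) • PowerSeries.mk (transportCoeff q)))]
  simp only [one_smul, map_sub, innerEuler, coeff_mk]
  exact inv_smul_mul_cast_succ n _

/-- `log (1 + x) ^ n`, written with Stirling numbers. -/
noncomputable def stirlingSeries (n : ℕ) : ℚ⟦X⟧ :=
  PowerSeries.mk fun j => (n.factorial : ℚ) / j.factorial * stirlingS1 j n

theorem stirlingSeries_zero : stirlingSeries 0 = 1 := by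
  ext j
  cases j <;> simp [stirlingSeries, stirlingS1, coeff_one]

theorem derivative_stirlingSeries_succ (n : ℕ) :
    (1 + X) * d⁄dX ℚ (stirlingSeries (n + 1)) = ((n : ℚ) + 1) • stirlingSeries n := by
  ext j
  have h : coeff j (X * d⁄dX ℚ (stirlingSeries (n + 1))) =
      (j : ℚ) * coeff j (stirlingSeries (n + 1)) := by
    cases j with
    | zero => simp
    | succ j => simp [coeff_succ_X_mul, coeff_derivative, mul_comm]
  rw [add_mul, one_mul, map_add, h, coeff_derivative, coeff_smul, smul_eq_mul]
  simp only [stirlingSeries, coeff_mk, stirlingS1, Nat.factorial_succ]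
  have := Nat.factorial_ne_zero j
  push_cast
  field_simp
  ring

theorem stirlingSeries_eq_pow (n : ℕ) : stirlingSeries n = stirlingSeries 1 ^ n := by
  induction n with
  | zero => simp [stirlingSeries_zero]
  | succ n ih =>
    have hX : (1 + X : ℚ⟦X⟧) ≠ 0 := fun h => by
      have := congrArg (coeff 0) h
      simp at this
    have h1 := derivative_stirlingSeries_succ 0
    have h2 := derivative_stirlingSeries_succ n
    apply PowerSeries.derivative.ext
    · apply mul_left_cancel₀ hX
      rw [h2, Derivation.leibniz_pow, ih]
      simp only [stirlingSeries_zero, Nat.cast_zero, zero_add, one_smul] at h1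
      simp only [nsmul_eq_mul, smul_eq_mul, Nat.add_sub_cancel, Algebra.smul_def, map_add,
        map_natCast, map_one]
      push_cast
      linear_combination (-((n : ℚ⟦X⟧) + 1) * stirlingSeries 1 ^ n) * h1
    · simp only [map_pow, ← coeff_zero_eq_constantCoeff_apply, stirlingSeries, coeff_mk]
      simp [stirlingS1]

theorem prod_range_add_succ (k n : ℕ) :
    (k.factorial : ℚ) * ∏ i ∈ Finset.range n, ((k : ℚ) + i + 1) = (k + n).factorial := by
  induction n with
  | zero => simp
  | succ n ih =>
    rw [Finset.prod_range_succ, ← mul_assoc, ih, ← add_assoc, Nat.factorial_succ]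
    push_cast
    ring

theorem stirling_convolution (L N : ℕ) :
    ∑ n ∈ Finset.HasAntidiagonal.antidiagonal L, ∑ k ∈ Finset.HasAntidiagonal.antidiagonal N,
      ((k.1 + n.1).factorial / ((k.1 + 1).factorial * k.1.factorial) *
          stirlingS1 (k.1 + 1) (n.1 + 1) : ℚ) *
        ((k.2 + n.2).factorial / ((k.2 + 1).factorial * k.2.factorial) *
          stirlingS1 (k.2 + 1) (n.2 + 1)) =
      2 * (L + 1) * (N + L + 1).factorial / ((N + 2).factorial * (N + 1).factorial) *
        stirlingS1 (N + 2) (L + 2) := by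
  obtain ⟨q, hq0, hq⟩ := exists_flow (stirlingSeries 1)
  obtain ⟨V, hV0, hV⟩ := exists_transport q
  have hU : d⁄dX ℚ⟦X⟧ (V * V) = q * (innerEuler (V * V) - (2 : ℚ) • (V * V)) := by
    simp only [Derivation.leibniz, hV, innerEuler_mul, two_smul, one_smul, smul_eq_mul]
    ring
  have hU0 : coeff 0 (V * V) = 1 := by
    rw [coeff_zero_eq_constantCoeff_apply] at hV0 ⊢
    rw [map_mul, hV0, one_mul]
  have hVc (n k : ℕ) : coeff (k + 1) (coeff (n + 1) V) =
      -((k + n).factorial / ((k + 1).factorial * k.factorial) *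
          stirlingS1 (k + 1) (n + 1) : ℚ) := by
    have h := coeff_of_flow hq hV hV0 n (k + 1)
    have hp := prod_range_add_succ k n
    rw [hq0, ← stirlingSeries_eq_pow, stirlingSeries, coeff_mk] at h
    have he : ∏ i ∈ Finset.range n, (((k + 1 : ℕ) : ℚ) + i + 1 - 1) =
        ∏ i ∈ Finset.range n, ((k : ℚ) + i + 1) :=
      Finset.prod_congr rfl fun i _ => by push_cast; ring
    rw [he] at h
    have h1 : ((n + 1).factorial : ℚ) ≠ 0 := by positivity
    have h2 : ((k + 1).factorial : ℚ) ≠ 0 := by positivity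
    have h3 : (k.factorial : ℚ) ≠ 0 := by positivity
    apply mul_left_cancel₀ h1
    rw [h, ← hp]
    field_simp
  have hVz (n : ℕ) : coeff 0 (coeff (n + 1) V) = 0 := by
    have h := coeff_of_flow hq hV hV0 n 0
    rw [hq0, ← stirlingSeries_eq_pow, stirlingSeries, coeff_mk] at h
    have h1 : ((n + 1).factorial : ℚ) ≠ 0 := by positivity
    apply mul_left_cancel₀ h1
    rw [h]
    simp [stirlingS1]
  have hUc : coeff (N + 2) (coeff (L + 2) (V * V)) =
      -2 * ((N + L + 1).factorial / ((N + 2).factorial * N.factorial) *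
          stirlingS1 (N + 2) (L + 2) : ℚ) := by
    have h := coeff_of_flow hq hU hU0 (L + 1) (N + 2)
    have hp := prod_range_add_succ N (L + 1)
    rw [hq0, ← stirlingSeries_eq_pow, stirlingSeries, coeff_mk] at h
    have he : ∏ i ∈ Finset.range (L + 1), (((N + 2 : ℕ) : ℚ) + i + 1 - 2) =
        ∏ i ∈ Finset.range (L + 1), ((N : ℚ) + i + 1) :=
      Finset.prod_congr rfl fun i _ => by push_cast; ring
    rw [he] at h
    have h1 : ((L + 1 + 1).factorial : ℚ) ≠ 0 := by positivity
    have h2 : ((N + 2).factorial : ℚ) ≠ 0 := by positivity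
    have h3 : (N.factorial : ℚ) ≠ 0 := by positivity
    apply mul_left_cancel₀ h1
    rw [h, add_assoc N, ← hp]
    field_simp
  have hsplit : coeff (N + 2) (coeff (L + 2) (V * V)) =
      2 * coeff (N + 2) (coeff (L + 2) V) +
        ∑ n ∈ Finset.HasAntidiagonal.antidiagonal L, ∑ k ∈ Finset.HasAntidiagonal.antidiagonal N,
          coeff (k.1 + 1) (coeff (n.1 + 1) V) * coeff (k.2 + 1) (coeff (n.2 + 1) V) := by
    rw [coeff_mul, Finset.Nat.antidiagonal_succ_succ']
    simp only [Finset.sum_cons, Finset.sum_map, map_add, map_sum, hV0, one_mul, mul_one,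
      Function.Embedding.coe_prodMap, Prod.map, Function.Embedding.coeFn_mk, Nat.succ_eq_add_one]
    have hin (n : ℕ × ℕ) : coeff (N + 2) (coeff (n.1 + 1) V * coeff (n.2 + 1) V) =
        ∑ k ∈ Finset.HasAntidiagonal.antidiagonal N,
          coeff (k.1 + 1) (coeff (n.1 + 1) V) * coeff (k.2 + 1) (coeff (n.2 + 1) V) := by
      rw [coeff_mul, Finset.Nat.antidiagonal_succ_succ']
      simp only [Finset.sum_cons, Finset.sum_map, hVz, zero_mul, mul_zero, zero_add,
        Function.Embedding.coe_prodMap, Prod.map, Function.Embedding.coeFn_mk,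
        Nat.succ_eq_add_one]
    simp only [hin]
    ring
  rw [hUc, hVc (L + 1) (N + 1)] at hsplit
  simp only [hVc, neg_mul_neg] at hsplit
  rw [← sub_eq_iff_eq_add'] at hsplit
  rw [← hsplit, show N + 1 + (L + 1) = N + L + 1 + 1 by ring, Nat.factorial_succ (N + L + 1),
    Nat.factorial_succ N]
  have h2 : ((N + 2).factorial : ℚ) ≠ 0 := by positivity
  have h3 : (N.factorial : ℚ) ≠ 0 := by positivity
  push_cast
  field_simp
  ring

end PowerSeriesFlow

theorem stirling_double_sum_identity (l m : ℕ) (hl : 1 ≤ l) (hm : 1 ≤ m) :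
    2 * (l : ℚ) * (stirlingS1 (1 + m) (1 + l) : ℚ) =
      (((m : ℚ) + 1) / ((l : ℚ) + (m : ℚ) - 1)) *
        ∑ n ∈ Finset.Icc 1 l, ∑ k ∈ Finset.range m,
          (((l + m - 2).choose (n + k - 1) : ℚ))⁻¹ * (m.choose k : ℚ) *
            (m.choose (1 + k) : ℚ) * (stirlingS1 (1 + k) n : ℚ) *
            (stirlingS1 (m - k) (l + 1 - n) : ℚ) := by
  obtain ⟨L, rfl⟩ := Nat.exists_eq_add_of_le' hl
  obtain ⟨N, rfl⟩ := Nat.exists_eq_add_of_le' hm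
  have hterm (n k : ℕ × ℕ) (hn : n ∈ Finset.HasAntidiagonal.antidiagonal L) (hk : k ∈ Finset.HasAntidiagonal.antidiagonal N) :
      (((L + 1 + (N + 1) - 2).choose (n.1 + 1 + k.1 - 1) : ℚ))⁻¹ * ((N + 1).choose k.1 : ℚ) *
            ((N + 1).choose (1 + k.1) : ℚ) * (stirlingS1 (1 + k.1) (n.1 + 1) : ℚ) *
            (stirlingS1 (N + 1 - k.1) (L + 1 + 1 - (n.1 + 1)) : ℚ) =
      ((N + 1).factorial ^ 2 / (N + L).factorial : ℚ) *
      (((k.1 + n.1).factorial / ((k.1 + 1).factorial * k.1.factorial) *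
          stirlingS1 (k.1 + 1) (n.1 + 1) : ℚ) *
        ((k.2 + n.2).factorial / ((k.2 + 1).factorial * k.2.factorial) *
          stirlingS1 (k.2 + 1) (n.2 + 1))) := by
    obtain ⟨a, b⟩ := n
    obtain ⟨c, d⟩ := k
    rw [Finset.HasAntidiagonal.mem_antidiagonal] at hn hk
    dsimp only at hn hk ⊢
    subst hn hk
    rw [show a + b + 1 + (c + d + 1) - 2 = (c + a) + (d + b) by omega,
      show a + 1 + c - 1 = c + a by omega, show c + d + 1 - c = d + 1 by omega,
      show a + b + 1 + 1 - (a + 1) = b + 1 by omega, show 1 + c = c + 1 by omega,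
      show c + d + (a + b) = (c + a) + (d + b) by omega,
      Nat.cast_choose ℚ (show c + a ≤ c + a + (d + b) by omega),
      Nat.cast_choose ℚ (show c ≤ c + d + 1 by omega),
      Nat.cast_choose ℚ (show c + 1 ≤ c + d + 1 by omega),
      show c + a + (d + b) - (c + a) = d + b by omega,
      show c + d + 1 - c = d + 1 by omega, show c + d + 1 - (c + 1) = d by omega]
    field_simp
  have hsum : ∑ n ∈ Finset.Icc 1 (L + 1), ∑ k ∈ Finset.range (N + 1),
          (((L + 1 + (N + 1) - 2).choose (n + k - 1) : ℚ))⁻¹ * ((N + 1).choose k : ℚ) *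
            ((N + 1).choose (1 + k) : ℚ) * (stirlingS1 (1 + k) n : ℚ) *
            (stirlingS1 (N + 1 - k) (L + 1 + 1 - n) : ℚ) =
      ((N + 1).factorial ^ 2 / (N + L).factorial : ℚ) *
        (2 * (L + 1) * (N + L + 1).factorial / ((N + 2).factorial * (N + 1).factorial) *
          stirlingS1 (N + 2) (L + 2)) := by
    rw [← stirling_convolution, Finset.mul_sum, ← Finset.Ico_add_one_right_eq_Icc,
      Finset.sum_Ico_eq_sum_range, Nat.add_sub_cancel,
      Finset.Nat.sum_antidiagonal_eq_sum_range_succ_mk]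
    refine Finset.sum_congr rfl fun n hn => ?_
    rw [Finset.mul_sum, Finset.Nat.sum_antidiagonal_eq_sum_range_succ_mk]
    refine Finset.sum_congr rfl fun k hk => ?_
    rw [Finset.mem_range] at hn hk
    rw [← hterm (n, L - n) (k, N - k)
      (Finset.HasAntidiagonal.mem_antidiagonal.2 (Nat.add_sub_of_le (by omega)))
      (Finset.HasAntidiagonal.mem_antidiagonal.2 (Nat.add_sub_of_le (by omega))), add_comm 1 n]
  rw [hsum, show 1 + (N + 1) = N + 2 by ring, show 1 + (L + 1) = L + 2 by ring,
    Nat.factorial_succ (N + L), Nat.factorial_succ (N + 1)]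
  have hd : ((L + 1 : ℕ) : ℚ) + ((N + 1 : ℕ) : ℚ) - 1 = (N : ℚ) + L + 1 := by
    push_cast
    ring
  rw [hd]
  push_cast
  field_simp
end

section
/- Define m_n(t) := n! * ∑_{j=⌈n/2⌉}^{n} t^j / (j! * (1+j)!) * s(1+j, n+1-j), where s denotes signed Stirling numbers of the first kind. Then the sequence c(n,k) := [t^k] m_n(t) = n! * s(1+k, n+1-k) / (k! * (1+k)!) satisfies the recursion (n-k) * c(n,k) = (n/2) * ∑_{l=0}^{k-1} ∑_{j=1}^{n-k} c(j+l-1, l) * c(n-l-j-1, k-1-l) for all n ≥ 2 and 1 ≤ k ≤ n-1. -/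
/-- The coefficients `c(n,k) = n! s(1+k, n+1-k) / (k! (1+k)!)` of the moment
polynomials `mₙ(t) = ∑ₖ c(n,k) tᵏ`. -/
noncomputable def momCoeff (n k : ℕ) : ℚ :=
  (n.factorial : ℚ) * (stirlingS1 (1 + k) (n + 1 - k) : ℚ) /
    ((k.factorial : ℚ) * ((1 + k).factorial : ℚ))

open PowerSeries Finset

section Derivation

variable {R : Type*} [CommRing R] [Algebra ℚ R]

/-- The coefficientwise extension of a derivation of `R` to `R⟦X⟧`. -/
noncomputable def coeffwiseDerivation (D : Derivation ℚ R R) : Derivation ℚ R⟦X⟧ R⟦X⟧ :=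
  Derivation.mk'
    { toFun := fun f => PowerSeries.mk fun n => D (coeff n f)
      map_add' := fun f g => by ext n; simp
      map_smul' := fun c f => by ext n; simp }
    (fun f g => by
      ext n
      simp only [LinearMap.coe_mk, AddHom.coe_mk, coeff_mk, coeff_mul, map_sum, Derivation.leibniz,
        smul_eq_mul, map_add, sum_add_distrib]
      rw [← Finset.Nat.sum_antidiagonal_swap (n := n)
        (f := fun p => coeff p.1 g * D (coeff p.2 f))]
      rfl)

theorem coeff_coeffwiseDerivation (D : Derivation ℚ R R) (f : R⟦X⟧) (n : ℕ) :
    coeff n (coeffwiseDerivation D f) = D (coeff n f) := by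
  simp [coeffwiseDerivation]

/-- The series `∑ₘ r / ((r + m) m!) Dᵐ(h^(m + r)) Xᵐ`, the `r`-th power of the solution `g` of the
inviscid Burgers equation `∂g/∂X = g D(g)` with initial value `h`. -/
noncomputable def burgersPow (D : Derivation ℚ R R) (h : R) (r : ℕ) : R⟦X⟧ :=
  PowerSeries.mk fun m => ((r : ℚ) / ((r + m) * m.factorial)) • D^[m] (h ^ (m + r))

theorem succ_smul_coeff_burgersPow (D : Derivation ℚ R R) (h : R) (r m : ℕ) :
    ((m + 1 : ℕ) : ℚ) • coeff (m + 1) (burgersPow D h r) =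
      ((r : ℚ) / (r + 1)) • D (coeff m (burgersPow D h (r + 1))) := by
  simp only [burgersPow, coeff_mk, Derivation.map_smul_of_tower, smul_smul,
    ← Function.iterate_succ_apply' D]
  rw [show m + 1 + r = m + (r + 1) by ring]
  congr 1
  have h1 : (m.factorial : ℚ) ≠ 0 := by positivity
  rw [Nat.factorial_succ]
  push_cast
  field_simp
  ring

theorem burgersPow_eq_pow (D : Derivation ℚ R R) (h : R) {r : ℕ} (hr : r ≠ 0) :
    burgersPow D h r = burgersPow D h 1 ^ r := by
  set g := burgersPow D h 1 with hg
  ext m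
  induction m using Nat.strong_induction_on generalizing r with
  | _ m ih =>
  cases m with
  | zero =>
    have h0 : ((r : ℚ)) ≠ 0 := by exact_mod_cast hr
    rw [coeff_zero_eq_constantCoeff_apply, coeff_zero_eq_constantCoeff_apply, map_pow]
    simp [hg, burgersPow, ← coeff_zero_eq_constantCoeff_apply, h0]
  | succ m =>
    have hD (s i : ℕ) (hi : i < m + 1) :
        ((i + 1 : ℕ) : ℚ) • coeff (i + 1) (burgersPow D h s) =
          coeff i ((s : ℚ) • (g ^ s * coeffwiseDerivation D g)) := by
      rw [succ_smul_coeff_burgersPow, ih i hi s.succ_ne_zero, ← coeff_coeffwiseDerivation,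
        Derivation.leibniz_pow, ← Nat.cast_smul_eq_nsmul ℚ, Nat.succ_sub_one, smul_eq_mul,
        coeff_smul, coeff_smul, smul_smul]
      congr 1
      push_cast
      field_simp
    have hderiv (f : R⟦X⟧) (i : ℕ) :
        coeff i (derivative R f) = ((i + 1 : ℕ) : ℚ) • coeff (i + 1) f := by
      rw [coeff_derivative, Nat.cast_smul_eq_nsmul, nsmul_eq_mul, mul_comm]
      push_cast
      rfl
    obtain ⟨s, rfl⟩ := Nat.exists_eq_succ_of_ne_zero hr
    have hcancel : ((m + 1 : ℕ) : ℚ) ≠ 0 := by positivity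
    rw [← smul_right_inj hcancel, hD _ m m.lt_succ_self, ← hderiv, Derivation.leibniz_pow,
      ← Nat.cast_smul_eq_nsmul ℚ, Nat.succ_sub_one, smul_eq_mul, coeff_smul, coeff_smul, pow_succ,
      mul_assoc, coeff_mul, coeff_mul]
    congr 1
    refine sum_congr rfl fun p hp => ?_
    have hp2 : p.2 < m + 1 := by
      have := mem_antidiagonal.mp hp
      omega
    rw [hderiv, hD 1 p.2 hp2, Nat.cast_one, one_smul, pow_one]

theorem sum_antidiagonal_iterate_derivation (D : Derivation ℚ R R) (h : R) (m : ℕ) :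
    ∑ p ∈ antidiagonal m,
      ((1 : ℚ) / (p.1 + 1).factorial) • D^[p.1] (h ^ (p.1 + 1)) *
        ((1 : ℚ) / (p.2 + 1).factorial) • D^[p.2] (h ^ (p.2 + 1)) =
      ((2 : ℚ) * (m + 1) / (m + 2).factorial) • D^[m] (h ^ (m + 2)) := by
  have key := congrArg (coeff m) (burgersPow_eq_pow D h two_ne_zero)
  rw [pow_two, coeff_mul] at key
  simp only [burgersPow, coeff_mk] at key
  convert key.symm using 2
  · simp only [Nat.factorial_succ]
    push_cast
    ring_nf
  · simp only [Nat.factorial_succ]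
    push_cast
    have h1 : (m.factorial : ℚ) ≠ 0 := by positivity
    field_simp
    ring

end Derivation

section Stirling

/-- The exponential generating function `∑ₖ r! s(k, r) Xᵏ / k!`. -/
noncomputable def stirlingEGF (r : ℕ) : ℚ⟦X⟧ :=
  PowerSeries.mk fun k => (r.factorial : ℚ) * stirlingS1 k r / k.factorial

theorem stirlingEGF_zero : stirlingEGF 0 = 1 := by
  ext k
  cases k <;> simp [stirlingEGF, stirlingS1, coeff_one]

theorem constantCoeff_stirlingEGF_succ (r : ℕ) : constantCoeff (stirlingEGF (r + 1)) = 0 := by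
  simp [stirlingEGF, stirlingS1, ← coeff_zero_eq_constantCoeff_apply]

theorem one_add_X_mul_derivative_stirlingEGF (r : ℕ) :
    (1 + X) * derivative ℚ (stirlingEGF (r + 1)) = ((r + 1 : ℕ) : ℚ⟦X⟧) * stirlingEGF r := by
  ext k
  have h1 : (k.factorial : ℚ) ≠ 0 := by positivity
  rw [← map_natCast (C (R := ℚ)), coeff_C_mul, add_mul, one_mul, map_add]
  cases k with
  | zero =>
    simp [stirlingEGF, stirlingS1, coeff_derivative, Nat.factorial_succ, mul_assoc]
  | succ k =>
    simp only [coeff_succ_X_mul, coeff_derivative, stirlingEGF, coeff_mk]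
    rw [stirlingS1.eq_4 (k + 1) r]
    simp only [Nat.factorial_succ] at h1 ⊢
    push_cast at h1 ⊢
    field_simp
    ring

theorem stirlingEGF_eq_pow (r : ℕ) : stirlingEGF r = stirlingEGF 1 ^ r := by
  induction r with
  | zero => simp [stirlingEGF_zero]
  | succ r ih =>
    have hX : (1 + X : ℚ⟦X⟧) ≠ 0 := fun h => by simpa using congrArg constantCoeff h
    refine derivative.ext (mul_left_cancel₀ hX ?_) ?_
    · have h1 := one_add_X_mul_derivative_stirlingEGF 0
      rw [stirlingEGF_zero] at h1
      rw [one_add_X_mul_derivative_stirlingEGF, Derivation.leibniz_pow, ih]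
      simp only [nsmul_eq_mul, smul_eq_mul, Nat.add_sub_cancel] at h1 ⊢
      push_cast at h1 ⊢
      linear_combination (-(r + 1) * stirlingEGF 1 ^ r) * h1
    · simp [constantCoeff_stirlingEGF_succ]

/-- The derivation `X² d/dX` of `ℚ⟦X⟧`. -/
noncomputable def sqDerivation : Derivation ℚ ℚ⟦X⟧ ℚ⟦X⟧ := (X ^ 2 : ℚ⟦X⟧) • derivative ℚ

theorem iterate_sqDerivation_X_mul (a : ℕ → ℚ) (m : ℕ) :
    sqDerivation^[m] (X * PowerSeries.mk a) =
      X ^ (m + 1) * PowerSeries.mk fun k => ((1 + k).ascFactorial m : ℚ) * a k := by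
  induction m with
  | zero => simp
  | succ m ih =>
    rw [Function.iterate_succ_apply', ih]
    have hstep (f : ℚ⟦X⟧) : sqDerivation (X ^ (m + 1) * f) =
        X ^ (m + 2) * (C (m + 1 : ℚ) * f + X * derivative ℚ f) := by
      simp only [sqDerivation, Derivation.smul_apply, smul_eq_mul, Derivation.leibniz,
        Derivation.leibniz_pow, derivative_X, nsmul_eq_mul, Nat.add_sub_cancel]
      simp
      ring
    rw [hstep]
    congr 1
    ext n
    rw [map_add, coeff_C_mul, coeff_mk, coeff_mk, Nat.ascFactorial_succ]
    cases n with
    | zero => simp; ring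
    | succ n =>
      simp only [coeff_succ_X_mul, coeff_derivative, coeff_mk]
      push_cast
      ring

theorem iterate_sqDerivation_stirlingEGF (r m : ℕ) :
    sqDerivation^[m] (stirlingEGF 1 ^ (r + 1)) =
      X ^ (m + 1) * PowerSeries.mk fun k => ((1 + k).ascFactorial m : ℚ) *
        ((r + 1).factorial * stirlingS1 (1 + k) (r + 1) / (1 + k).factorial) := by
  rw [← stirlingEGF_eq_pow, ← iterate_sqDerivation_X_mul]
  congr 1
  ext k
  cases k with
  | zero => simp [constantCoeff_stirlingEGF_succ]
  | succ k => simp [coeff_succ_X_mul, stirlingEGF, add_comm]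

theorem momCoeff_add (d k : ℕ) :
    momCoeff (d + k) k = ((1 : ℚ) / (d + 1).factorial) * (((1 + k).ascFactorial d : ℚ) *
        ((d + 1).factorial * stirlingS1 (1 + k) (d + 1) / (1 + k).factorial)) := by
  have h1 := Nat.factorial_mul_ascFactorial k d
  rw [momCoeff, show d + k + 1 - k = d + 1 by omega, add_comm d k, ← h1, add_comm 1 k]
  have h2 : (k.factorial : ℚ) ≠ 0 := by positivity
  have h3 : ((d + 1).factorial : ℚ) ≠ 0 := by positivity
  push_cast
  field_simp

theorem smul_iterate_sqDerivation_stirlingEGF (d : ℕ) :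
    ((1 : ℚ) / (d + 1).factorial) • sqDerivation^[d] (stirlingEGF 1 ^ (d + 1)) =
      X ^ (d + 1) * PowerSeries.mk fun k => momCoeff (d + k) k := by
  rw [iterate_sqDerivation_stirlingEGF, ← mul_smul_comm]
  congr 1
  ext k
  rw [coeff_smul, coeff_mk, coeff_mk, momCoeff_add, smul_eq_mul]

theorem sum_antidiagonal_momCoeff (d k : ℕ) :
    ∑ p ∈ antidiagonal d, ∑ q ∈ antidiagonal k,
      momCoeff (p.1 + q.1) q.1 * momCoeff (p.2 + q.2) q.2 =
      2 * (d + 1) / (d + k + 2) * momCoeff (d + 1 + (k + 1)) (k + 1) := by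
  have key := sum_antidiagonal_iterate_derivation sqDerivation (stirlingEGF 1) d
  simp only [smul_iterate_sqDerivation_stirlingEGF] at key
  have hpow : ∀ p ∈ antidiagonal d,
      (X ^ (p.1 + 1) * PowerSeries.mk fun k => momCoeff (p.1 + k) k) *
        (X ^ (p.2 + 1) * PowerSeries.mk fun k => momCoeff (p.2 + k) k) =
      X ^ (d + 2) * ((PowerSeries.mk fun k => momCoeff (p.1 + k) k) *
        PowerSeries.mk fun k => momCoeff (p.2 + k) k) := by
    intro p hp
    rw [← mem_antidiagonal.mp hp]
    ring
  rw [sum_congr rfl hpow, ← mul_sum, iterate_sqDerivation_stirlingEGF] at key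
  have hcoeff := congrArg (coeff (k + (d + 2))) key
  rw [coeff_X_pow_mul, coeff_smul, show k + (d + 2) = k + 1 + (d + 1) by ring, coeff_X_pow_mul,
    map_sum] at hcoeff
  simp only [coeff_mul, coeff_mk] at hcoeff
  rw [hcoeff, momCoeff_add, Nat.ascFactorial_succ, smul_eq_mul]
  push_cast
  field_simp
  ring

end Stirling

theorem momCoeff_recursion (n k : ℕ) (hn : 2 ≤ n) (hk1 : 1 ≤ k) (hk2 : k ≤ n - 1) :
    ((n : ℚ) - (k : ℚ)) * momCoeff n k =
      ((n : ℚ) / 2) *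
        ∑ l ∈ Finset.range k, ∑ j ∈ Finset.Icc 1 (n - k),
          momCoeff (j + l - 1) l * momCoeff (n - l - j - 1) (k - 1 - l) := by
  obtain ⟨k, rfl⟩ : ∃ a, k = a + 1 := ⟨k - 1, by omega⟩
  obtain ⟨d, rfl⟩ : ∃ d, n = d + 1 + (k + 1) := ⟨n - k - 2, by omega⟩
  have key := sum_antidiagonal_momCoeff d k
  rw [sum_comm, Finset.Nat.sum_antidiagonal_eq_sum_range_succ_mk] at key
  have hsum : ∑ l ∈ range (k + 1), ∑ j ∈ Icc 1 (d + 1 + (k + 1) - (k + 1)),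
      momCoeff (j + l - 1) l * momCoeff (d + 1 + (k + 1) - l - j - 1) (k + 1 - 1 - l) =
      2 * (d + 1) / (d + k + 2) * momCoeff (d + 1 + (k + 1)) (k + 1) := by
    rw [← key]
    refine sum_congr rfl fun l hl => ?_
    rw [Finset.Nat.sum_antidiagonal_eq_sum_range_succ_mk, Nat.add_sub_cancel,
      ← Finset.Ico_add_one_right_eq_Icc, Finset.sum_Ico_eq_sum_range]
    refine sum_congr rfl fun j hj => ?_
    rw [mem_range] at hl hj
    congr 2 <;> omega
  rw [hsum]
  push_cast
  field_simp
  ring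
end
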